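/- Let X ⊆ Y be finite metric spaces with |Y| ≥ k+1 for some k ∈ ℕ, and let c, ε ≥ 0 satisfy N_k(X,Y) ≤ c + ε. Suppose (s,S) is a layer point of L₀X[c] with s > c, i.e., S is a connected component of V_s(X), s ≥ c, and S is not a connected component of V_r(X) for any r with c ≤ r < s. Let T be the connected component of L_{s+ε,k}(Y) containing S (which exists), and let t = min{r ≥ 0 : T is a connected component of L_{r,k}(Y)}. Then this minimum exists and s − 2·h(Y,X) ≤ t ≤ s + ε. -/

import Mathlib

open Metric in
/-- The edge relation at scale `s` of the graph with vertex set `V`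
(inside an ambient metric space): an edge between distinct vertices at distance `≤ s`. -/
def adjRel {Y : Type*} [MetricSpace Y] (V : Set Y) (s : ℝ) (a b : Y) : Prop :=
  a ∈ V ∧ b ∈ V ∧ a ≠ b ∧ dist a b ≤ s

/-- Reachability (a path of edges) in the graph with vertex set `V` and edges
between distinct vertices at distance `≤ s`. -/
def Reach {Y : Type*} [MetricSpace Y] (V : Set Y) (s : ℝ) (a b : Y) : Prop :=
  Relation.ReflTransGen (adjRel V s) a b

/-- `S` is (the vertex set of) a connected component of the graph with vertex
set `V` and edges between distinct vertices at distance `≤ s`.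
For `V = X` this graph is the Vietoris–Rips graph `V_s(X)`. -/
def IsCC {Y : Type*} [MetricSpace Y] (V : Set Y) (s : ℝ) (S : Set Y) : Prop :=
  ∃ a ∈ V, S = {b | Reach V s a b}

/-- The vertex set of the Lesnick graph `L_{s,k}(Y)`: the points of `Y` having at
least `k` distinct `s`-neighbours in `Y`. -/
def lesnickVerts (Y : Type*) [MetricSpace Y] (k : ℕ) (s : ℝ) : Set Y :=
  {y | k ≤ Set.ncard {y' : Y | y' ≠ y ∧ dist y y' ≤ s}}

/-- The directional Hausdorff distance `h(Y, X) = max_{y ∈ Y} min_{x ∈ X} d(y, x)`. -/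
noncomputable def dirHaus {Y : Type*} [MetricSpace Y] (X : Set Y) : ℝ :=
  ⨆ y : Y, ⨅ x : X, dist y (x : Y)

/-- `N_k(X, Y) = max_{x ∈ X} min_S max_{y ∈ S} d(x, y)`, the minimum over all
`(k+1)`-element subsets `S ⊆ Y`. -/
noncomputable def Nk {Y : Type*} [MetricSpace Y] (k : ℕ) (X : Set Y) : ℝ :=
  ⨆ x : X, ⨅ S : {S : Finset Y // S.card = k + 1}, ⨆ y : (S : Finset Y), dist (x : Y) (y : Y)

lemma Reach.symm {Y : Type*} [MetricSpace Y] {V : Set Y} {s : ℝ} {a b : Y}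
    (h : Reach V s a b) : Reach V s b a := by
  induction h with
  | refl => exact Relation.ReflTransGen.refl
  | tail _ hbc ih =>
    exact Relation.ReflTransGen.head
      ⟨hbc.2.1, hbc.1, hbc.2.2.1.symm, (dist_comm _ _).trans_le hbc.2.2.2⟩ ih

lemma Reach.mono {Y : Type*} [MetricSpace Y] {V : Set Y} {r s : ℝ} (hrs : r ≤ s) {a b : Y}
    (h : Reach V r a b) : Reach V s a b :=
  Relation.ReflTransGen.mono (r := adjRel V r)
    (fun _ _ hxy => ⟨hxy.1, hxy.2.1, hxy.2.2.1, hxy.2.2.2.trans hrs⟩) _ _ h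

lemma Reach.mem {Y : Type*} [MetricSpace Y] {V : Set Y} {s : ℝ} {a b : Y} (ha : a ∈ V)
    (h : Reach V s a b) : b ∈ V := by
  cases h with
  | refl => exact ha
  | tail _ hbc => exact hbc.2.1

/-- Components of the Lesnick graph only depend on which distances are at most the scale. -/
lemma isCC_lesnickVerts_congr {Y : Type*} [MetricSpace Y] {k : ℕ} {r r' : ℝ} {T : Set Y}
    (h : ∀ a b : Y, dist a b ≤ r ↔ dist a b ≤ r') (hT : IsCC (lesnickVerts Y k r) r T) :
    IsCC (lesnickVerts Y k r') r' T := by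
  have hV : lesnickVerts Y k r = lesnickVerts Y k r' := by
    simp only [lesnickVerts, h]
  have hR : adjRel (lesnickVerts Y k r) r = adjRel (lesnickVerts Y k r') r' := by
    funext a b
    simp only [adjRel, h, hV]
  unfold IsCC Reach at hT ⊢
  rwa [← hR, ← hV]

/-- Every nonnegative scale of a finite metric space can be lowered to an attained distance
without changing which distances are at most the scale. -/
lemma exists_dist_le_iff {Y : Type*} [MetricSpace Y] [Finite Y] [Nonempty Y] {r : ℝ}
    (hr : 0 ≤ r) : ∃ p : Y × Y, dist p.1 p.2 ≤ r ∧
      ∀ a b : Y, dist a b ≤ r ↔ dist a b ≤ dist p.1 p.2 := by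
  obtain ⟨y⟩ := ‹Nonempty Y›
  obtain ⟨p, hp, hmax⟩ := Set.exists_max_image {p : Y × Y | dist p.1 p.2 ≤ r}
    (fun p => dist p.1 p.2) (Set.toFinite _) ⟨(y, y), by simpa using hr⟩
  exact ⟨p, hp, fun a b => ⟨fun hab => hmax (a, b) hab, fun hab => hab.trans hp⟩⟩

lemma exists_isLeast_isCC_lesnickVerts {Y : Type*} [MetricSpace Y] [Finite Y] {k : ℕ}
    {T : Set Y} {r : ℝ} (hr : 0 ≤ r) (hT : IsCC (lesnickVerts Y k r) r T) :
    ∃ t : ℝ, IsLeast {r : ℝ | 0 ≤ r ∧ IsCC (lesnickVerts Y k r) r T} t := by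
  have : Nonempty Y := ⟨hT.choose⟩
  obtain ⟨p₀, -, hp₀⟩ := exists_dist_le_iff (Y := Y) hr
  obtain ⟨p, hp, hmin⟩ := Set.exists_min_image
    {p : Y × Y | IsCC (lesnickVerts Y k (dist p.1 p.2)) (dist p.1 p.2) T}
    (fun p => dist p.1 p.2) (Set.toFinite _) ⟨p₀, isCC_lesnickVerts_congr hp₀ hT⟩
  refine ⟨dist p.1 p.2, ⟨dist_nonneg, hp⟩, fun u hu => ?_⟩
  obtain ⟨q, hqu, hq⟩ := exists_dist_le_iff (Y := Y) hu.1
  exact (hmin q (isCC_lesnickVerts_congr hq hu.2)).trans hqu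

lemma exists_dist_le_dirHaus {Y : Type*} [MetricSpace Y] [Finite Y] {X : Set Y}
    (hX : X.Nonempty) (y : Y) : ∃ x ∈ X, dist y x ≤ dirHaus X := by
  have : Nonempty X := hX.to_subtype
  obtain ⟨x, hx⟩ := exists_eq_ciInf_of_finite (f := fun x : X => dist y (x : Y))
  exact ⟨x, x.2, hx.trans_le
    (le_ciSup (f := fun y : Y => ⨅ x : X, dist y (x : Y)) (Set.finite_range _).bddAbove y)⟩

/-- Paths between points of `X` project to paths in `X`, increasing the scale by at most
twice the directional Hausdorff distance. -/
lemma Reach.project {Y : Type*} [MetricSpace Y] [Finite Y] {V X : Set Y} {t : ℝ} {x x' : Y}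
    (hx : x ∈ X) (hx' : x' ∈ X) (h : Reach V t x x') :
    Reach X (t + 2 * dirHaus X) x x' := by
  have key : ∀ y : Y, ∃ p ∈ X, dist y p ≤ dirHaus X ∧ (y ∈ X → p = y) := by
    intro y
    obtain ⟨p, hp, hyp⟩ := exists_dist_le_dirHaus ⟨x, hx⟩ y
    by_cases hy : y ∈ X
    · exact ⟨y, hy, by simpa using dist_nonneg.trans hyp, fun _ => rfl⟩
    · exact ⟨p, hp, hyp, fun h => absurd h hy⟩
  choose π hπX hπd hπ using key
  have := Relation.ReflTransGen.lift' (r := adjRel V t) (p := adjRel X (t + 2 * dirHaus X)) π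
    (fun a b hab => by
      by_cases hne : π a = π b
      · change Relation.ReflTransGen _ (π a) (π b)
        rw [hne]
      · refine Relation.ReflTransGen.single ⟨hπX a, hπX b, hne, ?_⟩
        have h₁ := dist_triangle4 (π a) a b (π b)
        have h₂ := hπd a
        rw [dist_comm] at h₂
        linarith [hπd b, hab.2.2.2]) _ _ h
  simpa only [Reach, Function.onFun, hπ x hx, hπ x' hx'] using this


/-- Let `(s,S)` be a layer point of `L₀X[c]` with `s > c`, where
`N_k(X,Y) ≤ c + ε`, and let `T` be the component of `L_{s+ε,k}(Y)` containing `S`.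
Then `t = min {r ≥ 0 : T is a component of L_{r,k}(Y)}` exists and satisfies
`s − 2·h(Y,X) ≤ t ≤ s + ε`. -/
theorem statement13 {Y : Type*} [MetricSpace Y] [Fintype Y] (k : ℕ) (X : Set Y)
    (hcard : k + 1 ≤ Fintype.card Y)
    (c ε : ℝ) (hc : 0 ≤ c) (hε : 0 ≤ ε) (hN : Nk k X ≤ c + ε)
    (s : ℝ) (S : Set Y) (hcs : c < s) (hS : IsCC X s S)
    (hlayer : ∀ r : ℝ, c ≤ r → r < s → ¬ IsCC X r S)
    (T : Set Y) (hT : IsCC (lesnickVerts Y k (s + ε)) (s + ε) T) (hST : S ⊆ T) :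
    ∃ t : ℝ, IsLeast {r : ℝ | 0 ≤ r ∧ IsCC (lesnickVerts Y k r) r T} t ∧
      s - 2 * dirHaus X ≤ t ∧ t ≤ s + ε := by
  obtain ⟨t, ht⟩ := exists_isLeast_isCC_lesnickVerts (by linarith : 0 ≤ s + ε) hT
  refine ⟨t, ht, ?_, ht.2 ⟨by linarith, hT⟩⟩
  by_contra! hlt
  obtain ⟨a, ha, rfl⟩ := hS
  obtain ⟨b, -, rfl⟩ := ht.1.2
  have hr : max c (t + 2 * dirHaus X) < s := max_lt hcs (by linarith)
  refine hlayer _ (le_max_left _ _) hr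
    ⟨a, ha, Set.Subset.antisymm (fun x hx => ?_) fun x hx => hx.mono hr.le⟩
  have hba : Reach _ t b a := hST Relation.ReflTransGen.refl
  have hbx : Reach _ t b x := hST hx
  exact (Reach.project ha (hx.mem ha) (hba.symm.trans hbx)).mono (le_max_right _ _)
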